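/- Let (x_{cs}) be a balanced server flow with loads α(s), and let (x*_{cs}) be any (not necessarily balanced) server flow with loads α*(s). Then ∑_{s ∈ S} α(s)² ≤ ∑_{s ∈ S} α(s)·α*(s). -/

import Mathlib

open scoped Classical

/-- The load of server `s` under flow `x`. -/
def load {C S : Type*} [Fintype C] (x : C → S → ℝ) (s : S) : ℝ := ∑ c, x c s

/-- `x` is a server flow: nonnegative, supported on edges, each client sends one unit. -/
def IsServerFlow {C S : Type*} [Fintype S] (Adj : C → S → Prop) (x : C → S → ℝ) : Prop :=
  (∀ c s, 0 ≤ x c s) ∧ (∀ c s, ¬ Adj c s → x c s = 0) ∧ (∀ c, ∑ s, x c s = 1)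

/-- `x` is balanced: each client only sends flow to its minimum-load neighbors. -/
def IsBalanced {C S : Type*} [Fintype C] [Fintype S] (Adj : C → S → Prop)
    (x : C → S → ℝ) : Prop :=
  ∀ c s, 0 < x c s → ∀ s', Adj c s' → load x s ≤ load x s'

/-- The active neighbors `A(c)` of a client `c`: the minimum-load neighbors of `c`. -/
noncomputable def activeN {C S : Type*} [Fintype C] [Fintype S] (Adj : C → S → Prop)
    (x : C → S → ℝ) (c : C) : Finset S :=
  Finset.univ.filter fun s => Adj c s ∧ ∀ s', Adj c s' → load x s ≤ load x s'


/-- The average load seen by a client under a balanced flow is at most the average load it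
would see by splitting its unit of flow according to any other server flow. -/
theorem IsBalanced.sum_load_mul_le {C S : Type*} [Fintype C] [Fintype S]
    {Adj : C → S → Prop} {x y : C → S → ℝ} (hx : IsServerFlow Adj x)
    (hbal : IsBalanced Adj x) (hy : IsServerFlow Adj y) (c : C) :
    ∑ s, load x s * x c s ≤ ∑ s, load x s * y c s := by
  obtain ⟨hx_nonneg, -, hx_sum⟩ := hx
  obtain ⟨hy_nonneg, hy_supp, hy_sum⟩ := hy
  calc ∑ s, load x s * x c s
      = ∑ s, ∑ t, load x s * (x c s * y c t) := by
        simp_rw [← mul_assoc, ← Finset.mul_sum, hy_sum, mul_one]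
    _ ≤ ∑ s, ∑ t, load x t * (x c s * y c t) := by
        refine Finset.sum_le_sum fun s _ => Finset.sum_le_sum fun t _ => ?_
        rcases (hx_nonneg c s).eq_or_lt with h | h
        · simp [← h]
        by_cases ht : Adj c t
        · exact mul_le_mul_of_nonneg_right (hbal c s h t ht)
            (mul_nonneg (hx_nonneg c s) (hy_nonneg c t))
        · simp [hy_supp c t ht]
    _ = ∑ t, load x t * y c t := by
        rw [Finset.sum_comm]
        refine Finset.sum_congr rfl fun t _ => ?_
        rw [← Finset.mul_sum, ← Finset.sum_mul, hx_sum, one_mul]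

/-- Weighting the loads of `y` by the loads of `x` amounts to summing over the clients. -/
theorem sum_load_mul_load {C S : Type*} [Fintype C] [Fintype S] (x y : C → S → ℝ) :
    ∑ s, load x s * load y s = ∑ c, ∑ s, load x s * y c s := by
  rw [Finset.sum_comm]
  exact Finset.sum_congr rfl fun s _ => Finset.mul_sum _ _ _

/-- If `x` is a balanced server flow with loads `α` and `x*` is any server flow with
loads `α*`, then `∑ α(s)² ≤ ∑ α(s)·α*(s)`. -/
theorem stmt_6 {C S : Type*} [Fintype C] [Fintype S]
    (Adj : C → S → Prop)
    (hnb : ∀ c : C, ∃ s, Adj c s)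
    (x xstar : C → S → ℝ)
    (hflow : IsServerFlow Adj x) (hbal : IsBalanced Adj x)
    (hflowstar : IsServerFlow Adj xstar) :
    ∑ s, (load x s) ^ 2 ≤ ∑ s, load x s * load xstar s := by
  simp_rw [sq]
  rw [sum_load_mul_load, sum_load_mul_load]
  exact Finset.sum_le_sum fun c _ => hbal.sum_load_mul_le hflow hflowstar c
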